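/- Let μ be a doubling measure on ℝⁿ, κ ∈ ℕ, and let f ∈ L²_loc(μ). Then for every dyadic cube I, the Alpert coefficient satisfies |f̂(I)| := ‖Δ_{I;κ}^μ f‖_{L²(μ)} ≲ (inf_{x∈I} M_μ|Δ_{I;κ}^μ f|(x))·√(μ(I)), where M_μ is the μ-Hardy–Littlewood maximal operator; equivalently, |f̂(I)|/√(μ(I)) ≲ inf_{x∈I} M_μ|Δ_{I;κ}^μ f|(x). -/

import Mathlib

open MeasureTheory
open scoped ENNReal

noncomputable section

/-- A dyadic cube in `ℝⁿ`, of side length `2^k`, with lower-left corner `2^k • m`. -/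
structure DyadicCube (n : ℕ) where
  k : ℤ
  m : Fin n → ℤ

namespace DyadicCube

variable {n : ℕ}

def toSet (Q : DyadicCube n) : Set (Fin n → ℝ) :=
  {x | ∀ i, (Q.m i : ℝ) * 2 ^ Q.k ≤ x i ∧ x i < ((Q.m i : ℝ) + 1) * 2 ^ Q.k}

def side (Q : DyadicCube n) : ℝ := 2 ^ Q.k

/-- The dyadic child of `Q` selected by `b`. -/
def child (Q : DyadicCube n) (b : Fin n → Bool) : DyadicCube n :=
  ⟨Q.k - 1, fun i => 2 * Q.m i + (if b i then 1 else 0)⟩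

end DyadicCube

/-- `g` agrees on `Q` with a polynomial of degree `< κ`. -/
def IsPolyOnCube (n κ : ℕ) (Q : DyadicCube n) (g : (Fin n → ℝ) → ℝ) : Prop :=
  ∃ p : MvPolynomial (Fin n) ℝ, p.totalDegree < κ ∧ ∀ x ∈ Q.toSet, g x = MvPolynomial.eval x p

/-- `E` is the family of `L²(μ)`-orthogonal projections `𝔼_{Q;κ}^μ` onto restrictions to `Q`
of polynomials of degree `< κ`. -/
def IsAlpertProjection (n κ : ℕ) (μ : Measure (Fin n → ℝ))
    (E : DyadicCube n → ((Fin n → ℝ) → ℝ) → ((Fin n → ℝ) → ℝ)) : Prop :=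
  ∀ Q f,
    (∀ x ∉ Q.toSet, E Q f x = 0) ∧
    IsPolyOnCube n κ Q (E Q f) ∧
    (∀ p : MvPolynomial (Fin n) ℝ, p.totalDegree < κ →
      ∫ x in Q.toSet, (f x - E Q f x) * MvPolynomial.eval x p ∂μ = 0)

/-- The weighted Alpert projection `Δ_{I;κ}^μ = (∑_{I' child of I} 𝔼_{I';κ}^μ) − 𝔼_{I;κ}^μ`. -/
def alpertDiff {n : ℕ} (E : DyadicCube n → ((Fin n → ℝ) → ℝ) → ((Fin n → ℝ) → ℝ))
    (I : DyadicCube n) (f : (Fin n → ℝ) → ℝ) : (Fin n → ℝ) → ℝ :=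
  fun x => (∑ b : Fin n → Bool, E (I.child b) f x) - E I f x

/-- An axis-parallel cube in `ℝⁿ` with center `c` and side length `r`. -/
structure Cube (n : ℕ) where
  c : Fin n → ℝ
  r : ℝ

namespace Cube

variable {n : ℕ}

def toSet (Q : Cube n) : Set (Fin n → ℝ) :=
  {x | ∀ i, |x i - Q.c i| ≤ Q.r / 2}

/-- Dilate a cube about its center by a factor `t`. -/
def dilate (Q : Cube n) (t : ℝ) : Cube n := ⟨Q.c, t * Q.r⟩

end Cube

/-- The `μ`-Hardy–Littlewood maximal function (over cubes). -/
def maximalFn {n : ℕ} (μ : Measure (Fin n → ℝ)) (g : (Fin n → ℝ) → ℝ)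
    (x : Fin n → ℝ) : ℝ≥0∞ :=
  ⨆ (Q : Cube n) (_ : 0 < Q.r) (_ : x ∈ Q.toSet),
    (∫⁻ y in Q.toSet, ENNReal.ofReal |g y| ∂μ) / μ Q.toSet


/-- Restriction of polynomials to the closed unit cube as continuous functions. -/
def polyRestr (n : ℕ) : MvPolynomial (Fin n) ℝ →ₗ[ℝ] C(Set.Icc (0 : Fin n → ℝ) 1, ℝ) where
  toFun p := ⟨fun x => MvPolynomial.eval x.1 p,
    (MvPolynomial.continuous_eval p).comp continuous_subtype_val⟩
  map_add' p q := by ext x; simp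
  map_smul' c p := by ext x; simp

lemma poly_core (n κ : ℕ) : ∃ δ : ℝ, 0 < δ ∧ δ ≤ 1 ∧
    ∀ p : MvPolynomial (Fin n) ℝ, p.totalDegree < κ →
    ∃ u₀ ∈ Set.Icc (0 : Fin n → ℝ) 1,
      (∀ y ∈ Set.Icc (0 : Fin n → ℝ) 1, |MvPolynomial.eval y p| ≤ |MvPolynomial.eval u₀ p|) ∧
      ∀ y ∈ Set.Icc (0 : Fin n → ℝ) 1, (∀ i, |y i - u₀ i| ≤ δ) →
        |MvPolynomial.eval u₀ p| / 2 ≤ |MvPolynomial.eval y p| := by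
  let K := Set.Icc (0 : Fin n → ℝ) 1
  have : CompactSpace K := isCompact_iff_compactSpace.mp isCompact_Icc
  let W : Submodule ℝ C(K, ℝ) := (MvPolynomial.restrictTotalDegree (Fin n) ℝ κ).map (polyRestr n)
  have : FiniteDimensional ℝ W := inferInstance
  have : ProperSpace W := FiniteDimensional.proper ℝ W
  let F : W × K → ℝ := fun z => z.1.1 z.2
  have hF : Continuous F := by
    have : Continuous fun z : W × K => ((z.1 : C(K, ℝ)), z.2) := by fun_prop
    exact ContinuousEval.continuous_eval.comp this
  have hc : IsCompact ((Metric.closedBall (0 : W) 1) ×ˢ (Set.univ : Set K)) :=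
    (isCompact_closedBall _ _).prod isCompact_univ
  have hu := hc.uniformContinuousOn_of_continuous hF.continuousOn
  obtain ⟨δ, hδ, H⟩ := Metric.uniformContinuousOn_iff_le.1 hu (1/2) (by norm_num)
  refine ⟨min δ 1, by positivity, min_le_right _ _, fun p hp => ?_⟩
  have hne : (Set.Icc (0 : Fin n → ℝ) 1).Nonempty := ⟨0, by simp⟩
  obtain ⟨u₀, hu₀, hmax⟩ := (isCompact_Icc (a := (0 : Fin n → ℝ)) (b := 1)).exists_isMaxOn hne
    (f := fun y => |MvPolynomial.eval y p|) (MvPolynomial.continuous_eval p).abs.continuousOn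
  refine ⟨u₀, hu₀, fun y hy => hmax hy, fun y hy hyd => ?_⟩
  set s := |MvPolynomial.eval u₀ p| with hs
  rcases (abs_nonneg (MvPolynomial.eval u₀ p)).eq_or_lt with h0 | h0
  · rw [← hs] at h0
    rw [← h0]; simp
  rw [← hs] at h0
  let q : W := ⟨s⁻¹ • polyRestr n p, W.smul_mem _ (Submodule.mem_map_of_mem
    ((MvPolynomial.mem_restrictTotalDegree _ _ _).2 hp.le))⟩
  have hqv : ∀ x : K, F (q, x) = s⁻¹ * MvPolynomial.eval x.1 p := fun x => rfl
  have hq : q ∈ Metric.closedBall (0 : W) 1 := by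
    rw [mem_closedBall_zero_iff]
    change ‖(q : C(K, ℝ))‖ ≤ 1
    rw [ContinuousMap.norm_le _ zero_le_one]
    intro x
    change ‖s⁻¹ * MvPolynomial.eval x.1 p‖ ≤ 1
    rw [norm_mul, Real.norm_eq_abs, Real.norm_eq_abs, abs_of_pos (inv_pos.2 h0),
      inv_mul_le_iff₀ h0, mul_one]
    exact hmax x.2
  have := H (q, ⟨u₀, hu₀⟩) ⟨hq, trivial⟩ (q, ⟨y, hy⟩) ⟨hq, trivial⟩ (by
    rw [Prod.dist_eq]
    refine max_le (by simpa using hδ.le) ?_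
    change dist u₀ y ≤ δ
    rw [dist_comm, dist_pi_le_iff hδ.le]
    intro i
    rw [Real.dist_eq]
    exact (hyd i).trans (min_le_left _ _))
  rw [hqv, hqv, Real.dist_eq, ← mul_sub, abs_mul, abs_of_pos (inv_pos.2 h0),
    inv_mul_le_iff₀ h0] at this
  have h3 := abs_sub_abs_le_abs_sub (MvPolynomial.eval u₀ p) (MvPolynomial.eval y p)
  simp only at this h3
  linarith

lemma totalDegree_affine (n κ : ℕ) (p : MvPolynomial (Fin n) ℝ) (hp : p.totalDegree < κ)
    (a : Fin n → ℝ) (h : ℝ) :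
    (MvPolynomial.bind₁ (fun i => MvPolynomial.C (a i) + MvPolynomial.C h * MvPolynomial.X i :
      Fin n → MvPolynomial (Fin n) ℝ) p).totalDegree < κ := by
  refine lt_of_le_of_lt ?_ hp
  rw [MvPolynomial.bind₁, MvPolynomial.aeval_def, MvPolynomial.eval₂_eq]
  refine MvPolynomial.totalDegree_finsetSum_le fun d hd => ?_
  refine (MvPolynomial.totalDegree_mul _ _).trans ?_
  rw [MvPolynomial.algebraMap_eq, MvPolynomial.totalDegree_C, zero_add]
  refine (MvPolynomial.totalDegree_finsetProd _ _).trans ?_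
  refine le_trans ?_ (MvPolynomial.le_totalDegree hd)
  refine Finset.sum_le_sum fun i _ => ?_
  refine (MvPolynomial.totalDegree_pow _ _).trans ?_
  have : (MvPolynomial.C (a i) + MvPolynomial.C h * MvPolynomial.X i :
      MvPolynomial (Fin n) ℝ).totalDegree ≤ 1 := by
    refine (MvPolynomial.totalDegree_add _ _).trans (max_le (by simp) ?_)
    refine (MvPolynomial.totalDegree_mul _ _).trans (by simp)
  calc d i * _ ≤ d i * 1 := Nat.mul_le_mul_left _ this
    _ = d i := mul_one _

lemma poly_scaled (n κ : ℕ) : ∃ δ : ℝ, 0 < δ ∧ δ ≤ 1 ∧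
    ∀ p : MvPolynomial (Fin n) ℝ, p.totalDegree < κ →
    ∀ (a : Fin n → ℝ) (h : ℝ), 0 < h →
    ∃ (c : Fin n → ℝ) (s : ℝ), 0 ≤ s ∧
      (∀ x : Fin n → ℝ, (∀ i, |x i - c i| ≤ (δ * h / 2) / 2) → ∀ i, a i ≤ x i ∧ x i < a i + h) ∧
      (∀ x : Fin n → ℝ, (∀ i, a i ≤ x i ∧ x i < a i + h) → |MvPolynomial.eval x p| ≤ s) ∧
      (∀ x : Fin n → ℝ, (∀ i, |x i - c i| ≤ (δ * h / 2) / 2) → s / 2 ≤ |MvPolynomial.eval x p|) := by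
  obtain ⟨δ, hδ, hδ1, H⟩ := poly_core n κ
  refine ⟨δ, hδ, hδ1, fun p hp a h hh => ?_⟩
  obtain ⟨u, hu, h1, h2⟩ := H _ (totalDegree_affine n κ p hp a h)
  have hev : ∀ y, MvPolynomial.eval y (MvPolynomial.bind₁
      (fun i => MvPolynomial.C (a i) + MvPolynomial.C h * MvPolynomial.X i :
      Fin n → MvPolynomial (Fin n) ℝ) p) = MvPolynomial.eval (fun i => a i + h * y i) p := by
    intro y
    simp only [← MvPolynomial.coe_aeval_eq_eval, RingHom.coe_coe, MvPolynomial.aeval_bind₁]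
    simp [MvPolynomial.aeval_def]
  simp only [hev] at h1 h2
  have key : ∀ x : Fin n → ℝ, (fun i => a i + h * ((x i - a i) / h)) = x := by
    intro x; ext i; field_simp; ring
  have hu0 : ∀ i, 0 ≤ u i := fun i => hu.1 i
  have hu1 : ∀ i, u i ≤ 1 := fun i => hu.2 i
  have hy : ∀ x : Fin n → ℝ, (∀ i, a i ≤ x i ∧ x i < a i + h) →
      (fun i => (x i - a i) / h) ∈ Set.Icc (0 : Fin n → ℝ) 1 := by
    intro x hx
    constructor
    · intro i
      exact div_nonneg (by linarith [hx i]) hh.le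
    · intro i
      change (x i - a i) / h ≤ 1
      rw [div_le_one hh]; linarith [hx i]
  have hsub : ∀ x : Fin n → ℝ, (∀ i, |x i - (a i + h * ((1 - δ) * u i + δ / 2))|
      ≤ (δ * h / 2) / 2) → ∀ i, a i ≤ x i ∧ x i < a i + h := by
    intro x hx i
    have h3 := abs_le.1 (hx i)
    have h4 : 0 ≤ h * ((1 - δ) * u i) :=
      mul_nonneg hh.le (mul_nonneg (by linarith) (hu0 i))
    have h5 : h * ((1 - δ) * u i) ≤ h * (1 - δ) := by
      apply mul_le_mul_of_nonneg_left _ hh.le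
      nlinarith [hu1 i]
    have h6 : 0 < δ * h := by positivity
    constructor <;> nlinarith
  refine ⟨fun i => a i + h * ((1 - δ) * u i + δ / 2),
    |MvPolynomial.eval (fun i => a i + h * u i) p|, abs_nonneg _, hsub, ?_, ?_⟩
  · intro x hx
    have := h1 _ (hy x hx)
    rwa [key] at this
  · intro x hx
    have := h2 _ (hy x (hsub x hx)) (by
      intro i
      have h3 := abs_le.1 (hx i)
      have h6 : 0 ≤ δ * h := by positivity
      have h7 : 0 ≤ δ * h * u i := mul_nonneg h6 (hu0 i)
      have h8 : δ * h * u i ≤ δ * h := mul_le_of_le_one_right h6 (hu1 i)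
      have : (x i - a i) / h - u i = (x i - a i - h * u i) / h := by field_simp
      rw [this, abs_div, abs_of_pos hh, div_le_iff₀ hh, abs_le]
      constructor <;> nlinarith)
    rwa [key] at this

lemma doubling_iter {n : ℕ} {Cd : ℝ≥0∞} {μ : Measure (Fin n → ℝ)}
    (hd : ∀ Q : Cube n, 0 < Q.r → μ (Q.dilate 2).toSet ≤ Cd * μ Q.toSet)
    (Q : Cube n) (hQ : 0 < Q.r) (N : ℕ) :
    μ (Q.dilate (2 ^ N)).toSet ≤ Cd ^ N * μ Q.toSet := by
  induction N with
  | zero => simp [Cube.dilate]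
  | succ N ih =>
    have h1 := hd (Q.dilate (2 ^ N)) (by simp only [Cube.dilate]; positivity)
    have h2 : (Q.dilate (2 ^ N)).dilate 2 = Q.dilate (2 ^ (N + 1)) := by
      simp only [Cube.dilate, pow_succ]; congr 1; ring
    rw [h2] at h1
    calc _ ≤ _ := h1
      _ ≤ Cd * (Cd ^ N * μ Q.toSet) := by gcongr
      _ = _ := by rw [pow_succ]; ring

lemma child_iff {n : ℕ} (I : DyadicCube n) (b : Fin n → Bool) (x : Fin n → ℝ) :
    x ∈ (I.child b).toSet ↔ ∀ i, ((I.m i : ℝ) * 2 + (if b i then 1 else 0)) * 2 ^ (I.k - 1) ≤ x i ∧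
      x i < ((I.m i : ℝ) * 2 + (if b i then 1 else 0)) * 2 ^ (I.k - 1) + 2 ^ (I.k - 1) := by
  simp only [DyadicCube.child, DyadicCube.toSet, Set.mem_ofPred_eq]
  refine forall_congr' fun i => ?_
  push_cast
  rw [mul_comm (2 : ℝ), add_mul _ (1 : ℝ), one_mul]

lemma two_zpow_pred (k : ℤ) : (2 : ℝ) ^ k = 2 * 2 ^ (k - 1) := by
  rw [zpow_sub_one₀ two_ne_zero]; field_simp

lemma child_subset {n : ℕ} (I : DyadicCube n) (b : Fin n → Bool) :
    (I.child b).toSet ⊆ I.toSet := by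
  intro x hx i
  have hx := (child_iff I b x).1 hx i
  rw [two_zpow_pred I.k]
  have : (0 : ℝ) < 2 ^ (I.k - 1) := by positivity
  generalize (2 : ℝ) ^ (I.k - 1) = h at *
  split_ifs at hx <;> constructor <;> nlinarith

lemma exists_child {n : ℕ} (I : DyadicCube n) (x : Fin n → ℝ) (hx : x ∈ I.toSet) :
    ∃ b, x ∈ (I.child b).toSet := by
  refine ⟨fun i => decide (((I.m i : ℝ) * 2 + 1) * 2 ^ (I.k - 1) ≤ x i), ?_⟩
  rw [child_iff]
  intro i
  have hx := hx i
  rw [two_zpow_pred I.k] at hx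
  by_cases h : ((I.m i : ℝ) * 2 + 1) * 2 ^ (I.k - 1) ≤ x i
  · have hd := decide_eq_true h
    simp only [hd, if_true]
    constructor <;> nlinarith
  · simp only [h, decide_false]
    push Not at h
    simp only [Bool.false_eq_true, if_false]
    constructor <;> nlinarith

lemma child_unique {n : ℕ} (I : DyadicCube n) (x : Fin n → ℝ) (b b' : Fin n → Bool)
    (h : x ∈ (I.child b).toSet) (h' : x ∈ (I.child b').toSet) : b = b' := by
  funext i
  have h := (child_iff I b x).1 h i
  have h' := (child_iff I b' x).1 h' i
  have : (0 : ℝ) < 2 ^ (I.k - 1) := by positivity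
  generalize (2 : ℝ) ^ (I.k - 1) = h at *
  cases hb : b i <;> cases hb' : b' i <;> simp [hb, hb'] at * <;> nlinarith

lemma alpert_poly {n κ : ℕ} {μ : Measure (Fin n → ℝ)}
    {E : DyadicCube n → ((Fin n → ℝ) → ℝ) → ((Fin n → ℝ) → ℝ)}
    (hE : IsAlpertProjection n κ μ E) (f : (Fin n → ℝ) → ℝ) (I : DyadicCube n)
    (b : Fin n → Bool) : IsPolyOnCube n κ (I.child b) (alpertDiff E I f) := by
  obtain ⟨p, hp, hpe⟩ := (hE (I.child b) f).2.1
  obtain ⟨q, hq, hqe⟩ := (hE I f).2.1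
  refine ⟨p - q, (MvPolynomial.totalDegree_sub _ _).trans_lt (max_lt hp hq), fun x hx => ?_⟩
  rw [map_sub, ← hpe x hx, ← hqe x (child_subset I b hx)]
  unfold alpertDiff
  congr 1
  refine Finset.sum_eq_single b (fun b' _ hb' => ?_) (by simp)
  exact (hE _ f).1 x fun h => hb' (child_unique I x b' b h hx)

lemma alpert_zero {n κ : ℕ} {μ : Measure (Fin n → ℝ)}
    {E : DyadicCube n → ((Fin n → ℝ) → ℝ) → ((Fin n → ℝ) → ℝ)}
    (hE : IsAlpertProjection n κ μ E) (f : (Fin n → ℝ) → ℝ) (I : DyadicCube n)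
    (x : Fin n → ℝ) (hx : x ∉ I.toSet) : alpertDiff E I f x = 0 := by
  unfold alpertDiff
  rw [(hE I f).1 x hx, Finset.sum_eq_zero, sub_zero]
  intro b _
  exact (hE _ f).1 x fun h => hx (child_subset I b h)

/-- The closed cube with the same center and side as a dyadic cube. -/
def closedCube {n : ℕ} (I : DyadicCube n) : Cube n :=
  ⟨fun i => ((I.m i : ℝ) + 1 / 2) * 2 ^ I.k, 2 ^ I.k⟩

lemma subset_closedCube {n : ℕ} (I : DyadicCube n) : I.toSet ⊆ (closedCube I).toSet := by
  intro x hx i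
  have := hx i
  simp only [closedCube]
  rw [abs_le]
  constructor <;> linarith

lemma cube_eq_pi {n : ℕ} (Q : Cube n) :
    Q.toSet = Set.Icc (fun i => Q.c i - Q.r / 2) (fun i => Q.c i + Q.r / 2) := by
  ext x
  simp only [Cube.toSet, Set.mem_ofPred_eq, Set.mem_Icc, Pi.le_def, ← forall_and, abs_le]
  refine forall_congr' fun i => ?_
  constructor <;> rintro ⟨h1, h2⟩ <;> constructor <;> linarith

theorem stmt_13 (n κ : ℕ) (hκ : 1 ≤ κ) (Cd : ℝ≥0∞) (hCd : Cd ≠ ∞) :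
    ∃ C > (0 : ℝ),
      ∀ (μ : Measure (Fin n → ℝ)), IsLocallyFiniteMeasure μ →
      (∀ Q : Cube n, 0 < Q.r → μ (Q.dilate 2).toSet ≤ Cd * μ Q.toSet) →
      ∀ E, IsAlpertProjection n κ μ E →
      ∀ (f : (Fin n → ℝ) → ℝ) (I : DyadicCube n),
        ENNReal.ofReal (Real.sqrt (∫ x, (alpertDiff E I f x) ^ 2 ∂μ)) ≤
          ENNReal.ofReal C * (⨅ x ∈ I.toSet, maximalFn μ (alpertDiff E I f) x) *
            (μ I.toSet) ^ (1 / 2 : ℝ) := by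
  obtain ⟨δ, hδ, hδ1, H⟩ := poly_scaled n κ
  obtain ⟨N, hN⟩ := pow_unbounded_of_one_lt (8 / δ) (one_lt_two (α := ℝ))
  refine ⟨2 * Cd.toReal ^ N + 1, by positivity, ?_⟩
  intro μ hμ hd E hE f I
  set g := alpertDiff E I f with hg
  have hCE : 2 * Cd ^ N ≤ ENNReal.ofReal (2 * Cd.toReal ^ N + 1) := by
    rw [← ENNReal.toReal_pow, ENNReal.le_ofReal_iff_toReal_le (by finiteness) (by positivity),
      ENNReal.toReal_mul]
    simp
  set C := ENNReal.ofReal (2 * Cd.toReal ^ N + 1) with hC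
  set J := closedCube I with hJ
  have hJr : 0 < J.r := by simp only [hJ, closedCube]; positivity
  have hJfin : μ J.toSet ≠ ∞ := by
    rw [cube_eq_pi]; exact isCompact_Icc.measure_lt_top.ne
  set M := ⨅ x ∈ I.toSet, maximalFn μ g x with hM
  -- average over J is below M
  have havg : (∫⁻ y in J.toSet, ENNReal.ofReal |g y| ∂μ) / μ J.toSet ≤ M := by
    refine le_iInf₂ fun x hx => ?_
    unfold maximalFn
    exact le_iSup_of_le J (le_iSup₂_of_le hJr (subset_closedCube I hx) le_rfl)
  by_cases hJ0 : μ J.toSet = 0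
  · have hI0 : μ I.toSet = 0 := measure_mono_null (subset_closedCube I) hJ0
    have : ∫ x, g x ^ 2 ∂μ = 0 := by
      refine integral_eq_zero_of_ae ?_
      have : ∀ᵐ x ∂μ, x ∉ I.toSet := measure_eq_zero_iff_ae_notMem.1 hI0
      filter_upwards [this] with x hx
      simp [hg, alpert_zero hE f I x hx]
    rw [this]; simp
  have hint : ∫⁻ y in J.toSet, ENNReal.ofReal |g y| ∂μ ≤ M * μ J.toSet :=
    (ENNReal.div_le_iff hJ0 hJfin).1 havg
  have hpt : ∀ y ∈ I.toSet, ENNReal.ofReal |g y| ≤ C * M := by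
    intro y hy
    obtain ⟨b, hb⟩ := exists_child I y hy
    obtain ⟨p, hp, hpe⟩ := alpert_poly hE f I b
    have hh : (0 : ℝ) < 2 ^ (I.k - 1) := by positivity
    obtain ⟨c, s, hs, h1, h2, h3⟩ := H p hp _ _ hh
    set S : Cube n := ⟨c, δ * 2 ^ (I.k - 1) / 2⟩ with hS
    have hSr : 0 < S.r := by simp only [hS]; positivity
    have hSsub : S.toSet ⊆ (I.child b).toSet := fun x hx => (child_iff I b x).2 (h1 x hx)
    have hSJ : S.toSet ⊆ J.toSet :=
      hSsub.trans ((child_subset I b).trans (subset_closedCube I))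
    have hcJ : c ∈ J.toSet := by
      apply hSJ
      intro i
      simp only [hS, sub_self, abs_zero]; positivity
    have hJS : J.toSet ⊆ (S.dilate (2 ^ N)).toSet := by
      intro x hx i
      have e1 := hx i
      have e2 := hcJ i
      have e3 : |x i - c i| ≤ J.r := by
        rw [abs_le] at *
        constructor <;> linarith
      refine e3.trans ?_
      simp only [hJ, closedCube, hS, Cube.dilate]
      rw [two_zpow_pred I.k]
      have : 8 ≤ 2 ^ N * δ := by rw [div_lt_iff₀ hδ] at hN; exact hN.le
      nlinarith
    have hmeas : μ J.toSet ≤ Cd ^ N * μ S.toSet :=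
      (measure_mono hJS).trans (doubling_iter hd S hSr N)
    have hlow : ENNReal.ofReal (s / 2) * μ S.toSet ≤ ∫⁻ y in J.toSet, ENNReal.ofReal |g y| ∂μ := by
      rw [← setLIntegral_const]
      refine le_trans ?_ (lintegral_mono_set hSJ)
      refine setLIntegral_mono' (by rw [cube_eq_pi]; exact measurableSet_Icc) fun x hx => ?_
      rw [hg, hpe x (hSsub hx)]
      exact ENNReal.ofReal_le_ofReal (h3 x hx)
    have hfin : ENNReal.ofReal (s / 2) ≤ Cd ^ N * M := by
      rw [← ENNReal.mul_le_mul_iff_left hJ0 hJfin]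
      calc ENNReal.ofReal (s / 2) * μ J.toSet
          ≤ ENNReal.ofReal (s / 2) * (Cd ^ N * μ S.toSet) := by gcongr
        _ = Cd ^ N * (ENNReal.ofReal (s / 2) * μ S.toSet) := by ring
        _ ≤ Cd ^ N * (M * μ J.toSet) := mul_le_mul' le_rfl (hlow.trans hint)
        _ = _ := by ring
    calc ENNReal.ofReal |g y| ≤ ENNReal.ofReal s := by
          rw [hg, hpe y hb]
          exact ENNReal.ofReal_le_ofReal (h2 y ((child_iff I b y).1 hb))
      _ = 2 * ENNReal.ofReal (s / 2) := by
          rw [← ENNReal.ofReal_ofNat, ← ENNReal.ofReal_mul (by norm_num)]; congr 1; ring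
      _ ≤ 2 * (Cd ^ N * M) := by gcongr
      _ = (2 * Cd ^ N) * M := by ring
      _ ≤ C * M := by gcongr
  have hsq : ENNReal.ofReal (∫ x, g x ^ 2 ∂μ) ≤ (C * M) ^ 2 * μ I.toSet := by
    calc ENNReal.ofReal (∫ x, g x ^ 2 ∂μ) ≤ ‖∫ x, g x ^ 2 ∂μ‖ₑ := by
          rw [← ofReal_norm]; exact ENNReal.ofReal_le_ofReal (le_abs_self _)
      _ ≤ ∫⁻ x, ‖g x ^ 2‖ₑ ∂μ := enorm_integral_le_lintegral_enorm _
      _ ≤ ∫⁻ x, I.toSet.indicator (fun _ => (C * M) ^ 2) x ∂μ := by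
          refine lintegral_mono fun x => ?_
          by_cases hx : x ∈ I.toSet
          · simp only [Set.indicator_of_mem hx]
            rw [enorm_pow, ← ofReal_norm, Real.norm_eq_abs]
            exact pow_le_pow_left₀ zero_le (hpt x hx) 2
          · simp [hg, alpert_zero hE f I x hx]
      _ ≤ ∫⁻ x in I.toSet, (C * M) ^ 2 ∂μ := lintegral_indicator_le _ _
      _ = _ := setLIntegral_const _ _
  have hnn : 0 ≤ ∫ x, g x ^ 2 ∂μ := integral_nonneg fun x => sq_nonneg _
  rw [Real.sqrt_eq_rpow, ← ENNReal.ofReal_rpow_of_nonneg hnn (by norm_num)]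
  refine (ENNReal.rpow_le_rpow hsq (by norm_num)).trans_eq ?_
  rw [ENNReal.mul_rpow_of_nonneg _ _ (by norm_num), ← ENNReal.rpow_natCast, ← ENNReal.rpow_mul]
  norm_num
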